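/- For every integer p ≥ 0 there exists a constant C_p > 0, depending only on p, with the following property: for every b > 0, every Dirac potential Q on [0,b] with (p+1)-times continuously differentiable entries, and every transmutation kernel K for Q which is (p+1)-times continuously differentiable on Ω⁺, setting M := max_{(x,t) ∈ Ω⁺} |∂ₜ^{p+1}K(x,t)|, one has for every integer N > p+1 and every (x,t) ∈ Ω⁺ with x > 0: |K(x,t) − K^N(x,t)| ≤ C_p·M·x^{p+1}/N^{p+1/2}. -/

import Mathlib

noncomputable section

open MeasureTheory Set Filter Topology Polynomial intervalIntegral

abbrev M2 : Type := Matrix (Fin 2) (Fin 2) ℂ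

attribute [local instance] Matrix.normedAddCommGroup Matrix.normedSpace

/-- The matrix `B` of the Dirac system. -/
def Bmat : M2 := !![0, 1; -1, 0]

/-- The Dirac potential built from the scalar functions `p, q`. -/
def diracPot (p q : ℝ → ℂ) : ℝ → M2 := fun x => !![p x, q x; q x, -p x]

/-- Operator norm of a `2 × 2` complex matrix, induced by the Euclidean norm on `ℂ²`. -/
def opNorm (A : M2) : ℝ := ‖Matrix.toEuclideanCLM (𝕜 := ℂ) A‖

/-- The Legendre polynomial of degree `n` (Rodrigues' formula). -/
def legendreP (n : ℕ) : Polynomial ℝ :=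
  ((2 ^ n * n.factorial : ℝ)⁻¹) • (fun r => derivative r)^[n] ((X ^ 2 - 1 : Polynomial ℝ) ^ n)

/-- The domain `Ω⁺ = {(x,t) : 0 ≤ x ≤ b, |t| ≤ x}`. -/
def OmegaPlus (b : ℝ) : Set (ℝ × ℝ) := {z | 0 ≤ z.1 ∧ z.1 ≤ b ∧ |z.2| ≤ z.1}

/-- `K` is a transmutation kernel for the potential `Q` on `Ω⁺`: it satisfies the
hyperbolic PDE `B⬝∂ₓK + ∂ₜK⬝B = -Q⬝K` together with the two Goursat conditions. -/
def IsTransKernel (b : ℝ) (Q : ℝ → M2) (K : ℝ → ℝ → M2) : Prop :=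
  (∀ x t : ℝ, (x, t) ∈ OmegaPlus b →
      Bmat * deriv (fun s => K s t) x + deriv (fun s => K x s) t * Bmat = -(Q x * K x t)) ∧
  (∀ x ∈ Set.Icc (0 : ℝ) b, Bmat * K x x - K x x * Bmat = -Q x) ∧
  (∀ x ∈ Set.Icc (0 : ℝ) b, Bmat * K x (-x) + K x (-x) * Bmat = 0)

/-- The `n`-th Fourier–Legendre coefficient `K_n(x)` of the kernel `K`. -/
def Kcoef (K : ℝ → ℝ → M2) (n : ℕ) (x : ℝ) : M2 :=
  ((2 * (n : ℝ) + 1) / 2) • ∫ t in (-x)..x, ((legendreP n).eval (t / x)) • K x t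

/-- The truncated kernel `K^N(x,t) = Σ_{n=0}^{N} (1/x)·K_n(x)·P_n(t/x)`. -/
def KN (K : ℝ → ℝ → M2) (N : ℕ) (x t : ℝ) : M2 :=
  ∑ n ∈ Finset.range (N + 1), (x⁻¹ * (legendreP n).eval (t / x)) • Kcoef K n x

/-- The free solution `U₀(λ,x)`. -/
def U0 (lam : ℂ) (x : ℝ) : M2 :=
  !![Complex.cos (lam * x), -Complex.sin (lam * x);
     Complex.sin (lam * x), Complex.cos (lam * x)]

/-- `U(λ,x) = U₀(λ,x) + ∫_{-x}^{x} K(x,t)·U₀(λ,t) dt`. -/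
def Umat (K : ℝ → ℝ → M2) (lam : ℂ) (x : ℝ) : M2 :=
  U0 lam x + ∫ t in (-x)..x, K x t * U0 lam t

/-- `U^N(λ,x) = U₀(λ,x) + ∫_{-x}^{x} K^N(x,t)·U₀(λ,t) dt`. -/
def UmatN (K : ℝ → ℝ → M2) (N : ℕ) (lam : ℂ) (x : ℝ) : M2 :=
  U0 lam x + ∫ t in (-x)..x, KN K N x t * U0 lam t

/-- `θ_n(x) = xⁿ·K_n(x)` for `n ≥ 0`, and `θ_{-1}(x) = -K₀(x)/x`. -/
def theta (K : ℝ → ℝ → M2) (n : ℤ) : ℝ → M2 := fun x =>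
  if n = -1 then -(x⁻¹ • Kcoef K 0 x) else (x ^ n.toNat : ℝ) • Kcoef K n.toNat x

/-- The integral operator `S[H](x) = U(x)·∫₀ˣ U(t)⁻¹·Bᵀ·H(t) dt`, where `U = U(0,·)`. -/
def Sop (U : ℝ → M2) (H : ℝ → M2) (x : ℝ) : M2 :=
  U x * ∫ t in (0 : ℝ)..x, (U t)⁻¹ * Bmat.transpose * H t


/-! ### Legendre polynomials: algebra -/

lemma iterD_mul_X (n : ℕ) (f : ℝ[X]) :
    derivative^[n + 1] (X * f) = X * derivative^[n + 1] f + ((n : ℝ[X]) + 1) * derivative^[n] f := by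
  rw [mul_comm X f, iterate_derivative_mul_X]
  simp [mul_comm]

def Wp (n : ℕ) : ℝ[X] := (X ^ 2 - 1) ^ n

lemma legendreP_eq (n : ℕ) :
    legendreP n = C ((2 ^ n * n.factorial : ℝ)⁻¹) * derivative^[n] (Wp n) := by
  rw [← smul_eq_C_mul]; rfl

lemma Wp_eq (n : ℕ) : derivative^[n] (Wp n) = C (2 ^ n * n.factorial : ℝ) * legendreP n := by
  rw [legendreP_eq, ← mul_assoc, ← C_mul, mul_inv_cancel₀ (by positivity), C_1, one_mul]

lemma legendreP_zero : legendreP 0 = 1 := by simp [legendreP]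

lemma legendreP_one : legendreP 1 = X := by
  rw [legendreP_eq]; simp [Wp]
  rw [← mul_assoc, show (1 + 1 : ℝ[X]) = C 2 by rw [map_ofNat]; norm_num, ← C_mul]; norm_num

lemma dW (n : ℕ) : derivative (Wp (n + 1)) = (2 * ((n : ℝ[X]) + 1)) * (X * Wp n) := by
  simp [Wp, derivative_pow, map_ofNat]; ring

lemma ddW (n : ℕ) : derivative^[2] (Wp (n + 2)) =
    (2 * ((n : ℝ[X]) + 2) * (2 * (n : ℝ[X]) + 3)) * Wp (n + 1)
      + (4 * ((n : ℝ[X]) + 1) * ((n : ℝ[X]) + 2)) * Wp n := by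
  simp only [Function.iterate_succ, Function.iterate_zero, Function.comp, id]
  rw [dW (n + 1)]
  have : derivative (2 * (((n + 1 : ℕ) : ℝ[X]) + 1) * (X * Wp (n + 1))) =
      (2 * (((n + 1 : ℕ) : ℝ[X]) + 1)) * (Wp (n + 1) + X * derivative (Wp (n + 1))) := by
    simp [derivative_mul]
  rw [this, dW n]
  have h : X ^ 2 * Wp n = Wp (n + 1) + Wp n := by simp only [Wp]; ring
  push_cast
  linear_combination (4 * ((n : ℝ[X]) + 1) * ((n : ℝ[X]) + 2)) * h

lemma iter_cast_mul (k : ℕ) (c : ℝ) (f : ℝ[X]) :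
    derivative^[k] (C c * f) = C c * derivative^[k] f := iterate_derivative_C_mul c f k

lemma legendreP_rec (n : ℕ) : derivative (legendreP (n + 2)) - derivative (legendreP n)
    = C (2 * (n : ℝ) + 3) * legendreP (n + 1) := by
  have h := congrArg (fun f => derivative^[n + 1] f) (ddW n)
  simp only [iterate_map_add] at h
  rw [← Function.iterate_add_apply, show n + 1 + 2 = 1 + (n + 2) by ring,
    Function.iterate_add_apply, Wp_eq,
    show (2 * ((n : ℝ[X]) + 2) * (2 * (n : ℝ[X]) + 3)) = C (2 * ((n : ℝ) + 2) * (2 * (n : ℝ) + 3)) by simp [map_ofNat],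
    show (4 * ((n : ℝ[X]) + 1) * ((n : ℝ[X]) + 2)) = C (4 * ((n : ℝ) + 1) * ((n : ℝ) + 2)) by simp [map_ofNat],
    iter_cast_mul, iter_cast_mul, iter_cast_mul, Wp_eq, show n + 1 = 1 + n by ring,
    Function.iterate_add_apply _ 1 n (Wp n), Wp_eq] at h
  simp only [Function.iterate_one, derivative_C_mul] at h
  have hc : C (2 ^ (n + 2) * (n + 2).factorial : ℝ) ≠ (0 : ℝ[X]) := by
    rw [Ne, C_eq_zero]; positivity
  apply mul_left_cancel₀ hc
  rw [mul_sub, h, show 1 + n = n + 1 by ring]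
  simp only [← mul_assoc, ← C_mul]
  have e1 : (4 * ((n : ℝ) + 1) * ((n : ℝ) + 2)) * (2 ^ n * n.factorial) = 2 ^ (n + 2) * (n + 2).factorial := by
    push_cast [Nat.factorial_succ]; ring
  have e2 : (2 * ((n : ℝ) + 2) * (2 * (n : ℝ) + 3)) * (2 ^ (n + 1) * (n + 1).factorial)
     = 2 ^ (n + 2) * (n + 2).factorial * (2 * (n : ℝ) + 3) := by
    push_cast [Nat.factorial_succ]; ring
  simp only [← mul_assoc] at e1 e2
  rw [e1, e2]; ring

lemma legendreP_ode (n : ℕ) :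
    derivative ((1 - X ^ 2) * derivative (legendreP n)) = - (C ((n : ℝ) * (n + 1)) * legendreP n) := by
  rcases n with _ | n
  · simp [legendreP_zero]
  have h0 : X * (X * derivative (Wp (n + 1))) - derivative (Wp (n + 1))
      = C (2 * ((n : ℝ) + 1)) * (X * Wp (n + 1)) := by
    rw [dW]; simp [Wp, map_ofNat]; ring
  have h := congrArg (fun f => derivative^[n + 2] f) h0
  simp only [iterate_derivative_sub] at h
  rw [iter_cast_mul, iterD_mul_X, iterD_mul_X, iterD_mul_X, iterD_mul_X] at h
  simp only [← Function.iterate_succ_apply] at h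
  rw [show (n + 1 + 1).succ = 2 + (n + 1) by omega, show (n+1).succ = 1 + (n + 1) by omega,
    show n + 1 + 1 = 1 + (n + 1) by omega,
    show n.succ = n + 1 by omega, Function.iterate_add_apply _ 2,
    Function.iterate_add_apply _ 1, Wp_eq] at h
  simp only [Function.iterate_succ, Function.iterate_zero, Function.comp, id, derivative_C_mul] at h
  have hc : C (2 ^ (n + 1) * (n + 1).factorial : ℝ) ≠ (0 : ℝ[X]) := by
    rw [Ne, C_eq_zero]; positivity
  apply mul_left_cancel₀ hc
  simp [derivative_mul, map_ofNat] at h ⊢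
  linear_combination -h

lemma legendreP_ode' (n : ℕ) : (1 - X ^ 2) * derivative (derivative (legendreP n))
    - 2 * X * derivative (legendreP n) = - (C ((n : ℝ) * (n + 1)) * legendreP n) := by
  rw [← legendreP_ode, derivative_mul]; simp; ring

lemma legendreP_eval_aux (n : ℕ) : ((legendreP n).eval 1 = 1 ∧ (legendreP (n + 1)).eval 1 = 1) ∧
    ((legendreP n).eval (-1) = (-1) ^ n ∧ (legendreP (n + 1)).eval (-1) = (-1) ^ (n + 1)) := by
  induction n with
  | zero => simp [legendreP_zero, legendreP_one]
  | succ n ih =>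
    refine ⟨⟨ih.1.2, ?_⟩, ⟨ih.2.2, ?_⟩⟩
    · have h1 := congrArg (eval 1) (legendreP_ode' n)
      have h2 := congrArg (eval 1) (legendreP_ode' (n + 2))
      have h3 := congrArg (eval 1) (legendreP_rec n)
      simp [ih.1] at h1 h2 h3
      have : ((n : ℝ) + 2) * (n + 3) * ((legendreP (n + 2)).eval 1 - 1) = 0 := by
        linear_combination 2 * h3 - h2 + h1
      have h4 : ((n : ℝ) + 2) * (n + 3) ≠ 0 := by positivity
      have := (mul_eq_zero.1 this).resolve_left h4
      show (legendreP (n + 2)).eval 1 = 1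
      linarith
    · have h1 := congrArg (eval (-1)) (legendreP_ode' n)
      have h2 := congrArg (eval (-1)) (legendreP_ode' (n + 2))
      have h3 := congrArg (eval (-1)) (legendreP_rec n)
      simp [ih.2] at h1 h2 h3
      have : ((n : ℝ) + 2) * (n + 3) * ((legendreP (n + 2)).eval (-1) - (-1) ^ (n + 2)) = 0 := by
        linear_combination -2 * h3 + h2 - h1
      have h4 : ((n : ℝ) + 2) * (n + 3) ≠ 0 := by positivity
      have := (mul_eq_zero.1 this).resolve_left h4
      show (legendreP (n + 2)).eval (-1) = (-1) ^ (n + 2)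
      linarith

lemma legendreP_eval_one (n : ℕ) : (legendreP n).eval 1 = 1 := (legendreP_eval_aux n).1.1
lemma legendreP_eval_neg_one (n : ℕ) : (legendreP n).eval (-1) = (-1) ^ n :=
  (legendreP_eval_aux n).2.1

lemma poly_eq_of_deriv {f g : ℝ[X]} (h : derivative f = derivative g) (h1 : f.eval 1 = g.eval 1) :
    f = g := by
  have h2 : derivative (f - g) = 0 := by simp [h]
  have h3 := eq_C_of_derivative_eq_zero h2
  have h4 : (f - g).eval 1 = 0 := by simp [h1]
  rw [h3] at h4
  simp only [eval_C] at h4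
  rw [h4, C_0] at h3
  exact sub_eq_zero.1 h3

lemma legendreP_diff (n : ℕ) : C (2 * (n : ℝ) + 3) * ((1 - X ^ 2) * derivative (legendreP (n + 1)))
    = C (((n : ℝ) + 1) * (n + 2)) * (legendreP n - legendreP (n + 2)) := by
  apply poly_eq_of_deriv
  · rw [derivative_C_mul, legendreP_ode, derivative_C_mul, derivative_sub]
    have h := legendreP_rec n
    push_cast at *
    have e : C ((n : ℝ) + 1 + 1) = C ((n : ℝ) + 2) := by congr 1; ring
    simp only [C_mul, e]
    linear_combination (C ((n : ℝ) + 1) * C ((n : ℝ) + 2)) * h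
  · simp [legendreP_eval_one]

/-! ### The integral functional on polynomials -/

def Jp (f : ℝ[X]) : ℝ := ∫ t in (-1 : ℝ)..1, f.eval t

lemma poly_ii (f : ℝ[X]) (a b : ℝ) : IntervalIntegrable (fun t => f.eval t) volume a b :=
  f.continuous.intervalIntegrable a b

lemma Jp_add (f g : ℝ[X]) : Jp (f + g) = Jp f + Jp g := by
  simp only [Jp, eval_add]; exact integral_add (poly_ii f _ _) (poly_ii g _ _)

lemma Jp_sub (f g : ℝ[X]) : Jp (f - g) = Jp f - Jp g := by
  simp only [Jp, eval_sub]; exact integral_sub (poly_ii f _ _) (poly_ii g _ _)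

lemma Jp_C_mul (c : ℝ) (f : ℝ[X]) : Jp (C c * f) = c * Jp f := by
  simp only [Jp, eval_mul, eval_C]; exact intervalIntegral.integral_const_mul c _

lemma Jp_neg (f : ℝ[X]) : Jp (-f) = -Jp f := by
  simp only [Jp, eval_neg]; exact intervalIntegral.integral_neg

lemma Jp_deriv (f : ℝ[X]) : Jp (derivative f) = f.eval 1 - f.eval (-1) :=
  integral_eq_sub_of_hasDerivAt (fun t _ => f.hasDerivAt t) (poly_ii _ _ _)

lemma Jp_mono {f g : ℝ[X]} (h : ∀ t ∈ Icc (-1 : ℝ) 1, f.eval t ≤ g.eval t) : Jp f ≤ Jp g :=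
  integral_mono_on (by norm_num) (poly_ii _ _ _) (poly_ii _ _ _) h

lemma Jp_parts (f g : ℝ[X]) : Jp (f * derivative g) =
    f.eval 1 * g.eval 1 - f.eval (-1) * g.eval (-1) - Jp (derivative f * g) := by
  have := Jp_deriv (f * g)
  rw [derivative_mul, Jp_add] at this
  simp at this
  linarith

lemma legendreP_orth {n m : ℕ} (h : n ≠ m) : Jp (legendreP n * legendreP m) = 0 := by
  have key : ∀ a b : ℕ, (a : ℝ) * (a + 1) * Jp (legendreP a * legendreP b)
      = Jp ((1 - X ^ 2) * derivative (legendreP a) * derivative (legendreP b)) := by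
    intro a b
    have := Jp_parts (legendreP b) ((1 - X ^ 2) * derivative (legendreP a))
    rw [legendreP_ode, mul_neg, Jp_neg, ← mul_assoc, mul_comm (legendreP b) (C _), mul_assoc,
      Jp_C_mul] at this
    simp at this
    rw [mul_comm (legendreP a), this]; congr 1; ring
  have h1 := key n m
  have h2 := key m n
  rw [mul_comm (legendreP m), show (1 - X ^ 2) * derivative (legendreP m) * derivative (legendreP n)
    = (1 - X ^ 2) * derivative (legendreP n) * derivative (legendreP m) by ring] at h2
  have h3 : (((n : ℝ) - m) * (n + m + 1)) * Jp (legendreP n * legendreP m) = 0 := by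
    linear_combination h1 - h2
  refine (mul_eq_zero.1 h3).resolve_left ?_
  refine mul_ne_zero (sub_ne_zero.2 (by exact_mod_cast h)) (by positivity)

lemma legendreP_orth_deriv_aux (m k : ℕ) :
    (k ≤ m → Jp (derivative (legendreP k) * legendreP m) = 0) ∧
    (k + 1 ≤ m → Jp (derivative (legendreP (k + 1)) * legendreP m) = 0) := by
  induction k with
  | zero =>
    constructor
    · intro _; simp [legendreP_zero, Jp]
    · intro h
      have := legendreP_orth (n := 0) (m := m) (by omega)
      simpa [legendreP_zero, legendreP_one] using this
  | succ k ih =>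
    refine ⟨ih.2, fun h => ?_⟩
    have h1 := ih.1 (by omega)
    have h2 := legendreP_rec k
    have h3 : derivative (legendreP (k + 1 + 1)) * legendreP m = derivative (legendreP k) * legendreP m
       + C (2 * (k : ℝ) + 3) * (legendreP (k + 1) * legendreP m) := by
      linear_combination legendreP m * h2
    rw [h3, Jp_add, h1, Jp_C_mul, legendreP_orth (by omega)]; simp

lemma legendreP_norm (n : ℕ) : Jp (legendreP n * legendreP n) = 2 / (2 * (n : ℝ) + 1) := by
  rcases n with _ | n
  · simp [legendreP_zero, Jp]; norm_num
  have h := Jp_parts (legendreP (n + 1)) (legendreP (n + 2) - legendreP n)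
  rw [derivative_sub, legendreP_rec, show legendreP (n + 1) * (C (2 * (n : ℝ) + 3) * legendreP (n + 1))
    = C (2 * (n : ℝ) + 3) * (legendreP (n + 1) * legendreP (n + 1)) by ring, Jp_C_mul, mul_sub, Jp_sub,
    (legendreP_orth_deriv_aux (n + 2) (n + 1)).1 (by omega),
    mul_comm (derivative (legendreP (n+1))), mul_comm (legendreP n)] at h
  have h2 := Jp_parts (legendreP n) (legendreP (n + 1))
  rw [(legendreP_orth_deriv_aux (n + 1) n).1 (by omega)] at h2
  rw [mul_comm (derivative _)] at h
  simp [legendreP_eval_one, legendreP_eval_neg_one] at h h2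
  rw [h2] at h
  have e : (-1 : ℝ) ^ n * (-1) ^ (n + 1) = -1 := by
    rw [← pow_add, show n + (n + 1) = 2 * n + 1 by ring, pow_succ, pow_mul]; simp
  rw [e] at h
  have : (2 * (n : ℝ) + 3) ≠ 0 := by positivity
  push_cast
  rw [eq_div_iff (by positivity)]
  have e2 : (-1 : ℝ) ^ (n + 2) = (-1) ^ n := by rw [pow_add]; simp
  rw [e2] at h
  linear_combination h

/-- every polynomial is a combination of Legendre polynomials -/
lemma legendreP_span (g : ℝ[X]) : g ∈ Submodule.span ℝ (Set.range legendreP) := by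
  have hanti : ∀ f ∈ Submodule.span ℝ (Set.range legendreP),
      ∃ F ∈ Submodule.span ℝ (Set.range legendreP), derivative F = f := by
    intro f hf
    induction hf using Submodule.span_induction with
    | mem x h =>
      obtain ⟨n, rfl⟩ := h
      rcases n with _ | n
      · exact ⟨legendreP 1, Submodule.subset_span ⟨1, rfl⟩, by simp [legendreP_one, legendreP_zero]⟩
      · refine ⟨(2 * (n : ℝ) + 3)⁻¹ • (legendreP (n + 2) - legendreP n),
          Submodule.smul_mem _ _ (Submodule.sub_mem _ (Submodule.subset_span ⟨_, rfl⟩)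
            (Submodule.subset_span ⟨_, rfl⟩)), ?_⟩
        rw [derivative_smul, derivative_sub, legendreP_rec, ← smul_eq_C_mul, smul_smul,
          inv_mul_cancel₀ (by positivity), one_smul]
    | zero => exact ⟨0, Submodule.zero_mem _, by simp⟩
    | add x y _ _ hx hy =>
      obtain ⟨F, hF, rfl⟩ := hx
      obtain ⟨G, hG, rfl⟩ := hy
      exact ⟨F + G, Submodule.add_mem _ hF hG, by simp⟩
    | smul a x _ hx =>
      obtain ⟨F, hF, rfl⟩ := hx
      exact ⟨a • F, Submodule.smul_mem _ _ hF, by simp⟩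
  have : ∀ n : ℕ, ∀ g : ℝ[X], g.natDegree ≤ n → g ∈ Submodule.span ℝ (Set.range legendreP) := by
    have hconst : ∀ c : ℝ, C c ∈ Submodule.span ℝ (Set.range legendreP) := by
      intro c
      have := Submodule.smul_mem (Submodule.span ℝ (Set.range legendreP)) c
        (Submodule.subset_span ⟨0, legendreP_zero⟩)
      rwa [smul_eq_C_mul, mul_one] at this
    intro n
    induction n with
    | zero => intro g hg; rw [eq_C_of_natDegree_le_zero hg]; exact hconst _
    | succ n ih =>
      intro g hg
      obtain ⟨F, hF, hd⟩ := hanti _ (ih (derivative g) ((natDegree_derivative_le g).trans (by omega)))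
      have h2 : derivative (g - F) = 0 := by simp [hd]
      have h3 := eq_C_of_derivative_eq_zero h2
      rw [← sub_add_cancel g F, h3]
      exact Submodule.add_mem _ (hconst _) hF
  exact this _ g le_rfl

/-! ### Bounds for Legendre polynomials -/

lemma poly_le_of_deriv_nonneg (G : ℝ[X]) {a b : ℝ} (hab : a ≤ b)
    (h : ∀ s ∈ Icc a b, 0 ≤ (derivative G).eval s) : G.eval a ≤ G.eval b := by
  have h1 : ∫ s in a..b, (derivative G).eval s = G.eval b - G.eval a :=
    integral_eq_sub_of_hasDerivAt (fun t _ => G.hasDerivAt t) (poly_ii _ _ _)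
  have h2 := integral_nonneg (μ := volume) hab h
  linarith

lemma legendreP_sq_le_one (n : ℕ) {t : ℝ} (ht : t ∈ Icc (-1 : ℝ) 1) :
    ((legendreP n).eval t) ^ 2 ≤ 1 := by
  rcases n with _ | n
  · simp [legendreP_zero]
  set c : ℝ := ((n + 1 : ℕ) : ℝ) * (((n + 1 : ℕ) : ℝ) + 1) with hc
  have hcpos : 0 < c := by rw [hc]; positivity
  set P := legendreP (n + 1) with hP
  set G : ℝ[X] := C c * P ^ 2 + (1 - X ^ 2) * (derivative P) ^ 2 with hG
  have hode := legendreP_ode' (n + 1)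
  rw [← hc, ← hP] at hode
  have hd : derivative G = 2 * X * (derivative P) ^ 2 := by
    simp [hG, derivative_mul, derivative_pow, map_ofNat]
    linear_combination 2 * derivative P * hode
  have hGt : c * (P.eval t) ^ 2 ≤ G.eval t := by
    simp [hG]
    have : 0 ≤ 1 - t ^ 2 := by nlinarith [ht.1, ht.2]
    positivity
  have hG1 : G.eval t ≤ c := by
    rcases le_total 0 t with h0 | h0
    · have := poly_le_of_deriv_nonneg G ht.2 (by
        intro s hs
        have : 0 ≤ s := h0.trans hs.1
        rw [hd]; simp; positivity)
      simpa [hG, hP, legendreP_eval_one] using this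
    · have := poly_le_of_deriv_nonneg (-G) ht.1 (by
        intro s hs
        have : 0 ≤ -s := by linarith [hs.2]
        rw [derivative_neg, hd]; simp
        nlinarith [mul_nonneg this (sq_nonneg (eval s (derivative P)))])
      simp [hG, hP, legendreP_eval_neg_one, ← pow_mul] at this
      simpa [hG] using this
  by_contra hcon
  push Not at hcon
  nlinarith

lemma legendreP_u_bound (n : ℕ) {t : ℝ} (ht : t ∈ Icc (-1 : ℝ) 1) :
    ((1 - t ^ 2) * (derivative (legendreP (n + 1))).eval t) ^ 2 ≤ 2 * ((n : ℝ) + 2) := by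
  set c : ℝ := ((n + 1 : ℕ) : ℝ) * (((n + 1 : ℕ) : ℝ) + 1) with hc
  have hcpos : 0 < c := by rw [hc]; positivity
  set P := legendreP (n + 1) with hP
  set F : ℝ[X] := ((1 - X ^ 2) * derivative P) ^ 2 + C c * ((1 - X ^ 2) * P ^ 2) with hF
  have hode := legendreP_ode (n + 1)
  rw [← hc, ← hP] at hode
  have hd : derivative F = - (2 * X * (C c * P ^ 2)) := by
    rw [hF, derivative_add, derivative_pow, hode]
    simp [derivative_mul, derivative_pow, map_ofNat]
    ring
  have h1 : ∫ s in t..1, (derivative (-F)).eval s = (-F).eval 1 - (-F).eval t :=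
    integral_eq_sub_of_hasDerivAt (fun t _ => (-F).hasDerivAt t) (poly_ii _ _ _)
  have h2 : ∫ s in t..1, (derivative (-F)).eval s ≤ ∫ s in t..1, (C (2 * c) * (P * P)).eval s := by
    apply integral_mono_on ht.2 (poly_ii _ _ _) (poly_ii _ _ _)
    intro s hs
    rw [derivative_neg, hd]; simp
    have : 0 ≤ (1 - s) * (c * eval s P ^ 2) := mul_nonneg (by linarith [hs.2]) (by positivity)
    nlinarith
  have h3 : ∫ s in t..1, (C (2 * c) * (P * P)).eval s ≤ Jp (C (2 * c) * (P * P)) := by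
    apply integral_mono_interval ht.1 ht.2 le_rfl _ (poly_ii _ _ _)
    refine Filter.Eventually.of_forall fun s => ?_
    simp only [eval_mul, eval_C, Pi.zero_apply]
    have := mul_self_nonneg (eval s P)
    positivity
  rw [Jp_C_mul, hP, legendreP_norm] at h3
  have h4 : (-F).eval 1 = 0 := by simp [hF]
  have h5 : 2 * c * (2 / (2 * ((n + 1 : ℕ) : ℝ) + 1)) ≤ 2 * ((n : ℝ) + 2) := by
    rw [hc]; push_cast
    rw [mul_div_assoc', div_le_iff₀ (by positivity)]
    have : (0 : ℝ) ≤ n := by positivity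
    nlinarith
  have h6 : ((1 - t ^ 2) * (derivative P).eval t) ^ 2 ≤ F.eval t := by
    simp [hF]
    have : 0 ≤ 1 - t ^ 2 := by nlinarith [ht.1, ht.2]
    positivity
  have h7 : (-F).eval t = -(F.eval t) := by simp
  linarith

lemma legendreP_diff_bound (n : ℕ) {t : ℝ} (ht : t ∈ Icc (-1 : ℝ) 1) :
    ((legendreP (n + 2)).eval t - (legendreP n).eval t) ^ 2
      ≤ 4 * (2 * (n : ℝ) + 3) / ((n : ℝ) + 1) ^ 2 := by
  have h := congrArg (eval t) (legendreP_diff n)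
  simp only [eval_mul, eval_C, eval_sub, eval_one, eval_pow, eval_X] at h
  have hu := legendreP_u_bound n ht
  set u := (1 - t ^ 2) * (derivative (legendreP (n + 1))).eval t
  set d := (legendreP (n + 2)).eval t - (legendreP n).eval t with hd
  have h' : ((n : ℝ) + 1) * (n + 2) * d = -((2 * (n : ℝ) + 3) * u) := by rw [h, hd]; ring
  have hn : (0 : ℝ) ≤ n := by positivity
  have h2 : (((n : ℝ) + 1) * (n + 2)) ^ 2 * d ^ 2 = (2 * (n : ℝ) + 3) ^ 2 * u ^ 2 := by
    rw [← mul_pow, h']; ring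
  have h3 : (2 * (n : ℝ) + 3) ^ 2 * u ^ 2 ≤ (2 * (n : ℝ) + 3) ^ 2 * (2 * ((n : ℝ) + 2)) := by gcongr
  rw [le_div_iff₀ (by positivity)]
  have h4 : (2 * (n : ℝ) + 3) ^ 2 * (2 * ((n : ℝ) + 2)) ≤ 4 * (2 * (n : ℝ) + 3) * ((n : ℝ) + 2) ^ 2 := by
    have : 0 ≤ (2 * (n : ℝ) + 3) * ((n : ℝ) + 2) := by positivity
    nlinarith
  have h5 : (d ^ 2 * ((n : ℝ) + 1) ^ 2) * ((n : ℝ) + 2) ^ 2 ≤ 4 * (2 * (n : ℝ) + 3) * ((n : ℝ) + 2) ^ 2 := by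
    nlinarith
  exact le_of_mul_le_mul_right h5 (by positivity)

/-! ### Legendre coefficients of polynomials -/

def Ip (n : ℕ) (g : ℝ[X]) : ℝ := Jp (g * legendreP n)

lemma Ip_rec (n : ℕ) (g : ℝ[X]) :
    (2 * (n : ℝ) + 3) * Ip (n + 1) g = Ip n (derivative g) - Ip (n + 2) (derivative g) := by
  have h := Jp_parts g (legendreP (n + 2) - legendreP n)
  rw [derivative_sub, legendreP_rec, show g * (C (2 * (n : ℝ) + 3) * legendreP (n + 1))
    = C (2 * (n : ℝ) + 3) * (g * legendreP (n + 1)) by ring, Jp_C_mul, mul_sub, Jp_sub] at h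
  simp [legendreP_eval_one, legendreP_eval_neg_one, pow_add] at h
  simp only [Ip]
  linarith

def Sp (L : ℕ) (g : ℝ[X]) : ℝ[X] :=
  ∑ n ∈ Finset.range L, C ((2 * (n : ℝ) + 1) / 2 * Ip n g) * legendreP n

lemma Sp_orth (L m : ℕ) (h : L ≤ m) (g : ℝ[X]) : Jp (Sp L g * legendreP m) = 0 := by
  induction L with
  | zero => simp [Sp, Jp]
  | succ L ih =>
    rw [Sp, Finset.sum_range_succ, add_mul, Jp_add, mul_assoc, Jp_C_mul, legendreP_orth (by omega)]
    have := ih (by omega)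
    rw [Sp] at this
    rw [this]; simp

lemma bessel_eq (L : ℕ) (g : ℝ[X]) : Jp ((g - Sp L g) ^ 2) =
    Jp (g ^ 2) - ∑ m ∈ Finset.range L, (2 * (m : ℝ) + 1) / 2 * Ip m g ^ 2 := by
  induction L with
  | zero => simp [Sp]
  | succ L ih =>
    rw [Finset.sum_range_succ, ← sub_sub, ← ih]
    have e : Sp (L + 1) g = Sp L g + C ((2 * (L : ℝ) + 1) / 2 * Ip L g) * legendreP L := by
      simp [Sp, Finset.sum_range_succ]
    set a := (2 * (L : ℝ) + 1) / 2 * Ip L g with ha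
    have e2 : (g - Sp (L + 1) g) ^ 2 = (g - Sp L g) ^ 2 - C (2 * a) * (g * legendreP L)
        + C (2 * a) * (Sp L g * legendreP L) + C (a ^ 2) * (legendreP L * legendreP L) := by
      rw [e]; simp [map_ofNat]; ring
    rw [e2, Jp_add, Jp_add, Jp_sub, Jp_C_mul, Jp_C_mul, Jp_C_mul, Sp_orth _ _ le_rfl, legendreP_norm,
      show Jp (g * legendreP L) = Ip L g from rfl, ha]
    have : 2 * (L : ℝ) + 1 ≠ 0 := by positivity
    field_simp
    ring

lemma bessel (L : ℕ) (g : ℝ[X]) (M : ℝ) (hM : ∀ t ∈ Icc (-1 : ℝ) 1, |g.eval t| ≤ M) :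
    ∑ m ∈ Finset.range L, (2 * (m : ℝ) + 1) * Ip m g ^ 2 ≤ 4 * M ^ 2 := by
  have h1 : 0 ≤ Jp ((g - Sp L g) ^ 2) := by
    have : Jp 0 ≤ Jp ((g - Sp L g) ^ 2) := Jp_mono (fun t _ => by
      simp only [eval_zero, eval_pow]; positivity)
    simpa [Jp] using this
  have h2 : Jp (g ^ 2) ≤ 2 * M ^ 2 := by
    have : Jp (g ^ 2) ≤ Jp (C (M ^ 2)) := Jp_mono (fun t ht => by
      have := hM t ht
      have h0 := abs_nonneg (g.eval t)
      simp only [eval_pow, eval_C]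
      rw [← sq_abs (g.eval t)]
      gcongr)
    refine this.trans (le_of_eq ?_)
    simp [Jp]; norm_num
  rw [bessel_eq] at h1
  have : ∑ m ∈ Finset.range L, (2 * (m : ℝ) + 1) * Ip m g ^ 2
      = 2 * ∑ m ∈ Finset.range L, (2 * (m : ℝ) + 1) / 2 * Ip m g ^ 2 := by
    rw [Finset.mul_sum]; refine Finset.sum_congr rfl fun m _ => by ring
  rw [this]; linarith

lemma Sp_eventually (g : ℝ[X]) : ∃ L0, ∀ L ≥ L0, Sp L g = g := by
  have hI : ∀ n f h, Ip n (f + h) = Ip n f + Ip n h := by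
    intro n f h; simp only [Ip]; rw [add_mul, Jp_add]
  have hIs : ∀ n (a : ℝ) f, Ip n (a • f) = a * Ip n f := by
    intro n a f; simp only [Ip]; rw [smul_eq_C_mul, mul_assoc, Jp_C_mul]
  induction legendreP_span g using Submodule.span_induction with
  | mem x h =>
    obtain ⟨n, rfl⟩ := h
    refine ⟨n + 1, fun L hL => ?_⟩
    rw [Sp, Finset.sum_eq_single n]
    · rw [Ip, legendreP_norm]
      have : (2 * (n : ℝ) + 1) ≠ 0 := by positivity
      rw [show (2 * (n : ℝ) + 1) / 2 * (2 / (2 * (n : ℝ) + 1)) = 1 by field_simp]; simp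
    · intro m _ hm
      rw [Ip, legendreP_orth hm.symm]; simp
    · intro h; simp at h; omega
  | zero => exact ⟨0, fun L _ => by simp [Sp, Ip, Jp]⟩
  | add x y _ _ hx hy =>
    obtain ⟨L1, h1⟩ := hx
    obtain ⟨L2, h2⟩ := hy
    refine ⟨max L1 L2, fun L hL => ?_⟩
    conv_rhs => rw [← h1 L (le_trans (le_max_left _ _) hL), ← h2 L (le_trans (le_max_right _ _) hL)]
    simp only [Sp, ← Finset.sum_add_distrib]
    refine Finset.sum_congr rfl fun n _ => ?_
    rw [hI, mul_add, C_add, add_mul]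
  | smul a x _ hx =>
    obtain ⟨L1, h1⟩ := hx
    refine ⟨L1, fun L hL => ?_⟩
    conv_rhs => rw [← h1 L hL]
    simp only [Sp, Finset.smul_sum]
    refine Finset.sum_congr rfl fun n _ => ?_
    rw [hIs, smul_eq_C_mul]; simp only [C_mul]; ring

lemma Ip_eventually (g : ℝ[X]) : ∃ L0, ∀ L ≥ L0, Ip L g = 0 := by
  obtain ⟨L0, h⟩ := Sp_eventually g
  refine ⟨L0, fun L hL => ?_⟩
  have h1 := h L hL
  have h2 := h (L + 1) (by omega)
  rw [Sp, Finset.sum_range_succ, ← Sp, h1] at h2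
  have h3 := congrArg (eval 1) h2
  simp [legendreP_eval_one] at h3
  exact h3.resolve_left (by positivity)

def Tp (n L : ℕ) (g : ℝ[X]) : ℝ := ∑ m ∈ Finset.Ico n L, (2 * (m : ℝ) + 1) * Ip m g ^ 2

lemma Tp_mono {n n' L L' : ℕ} (hn : n' ≤ n) (hL : L ≤ L') (g : ℝ[X]) : Tp n L g ≤ Tp n' L' g :=
  Finset.sum_le_sum_of_subset_of_nonneg (Finset.Ico_subset_Ico hn hL)
    (fun i _ _ => by positivity)

lemma Tp_step (n L : ℕ) (g : ℝ[X]) :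
    Tp (n + 1) (L + 1) g ≤ 2 / ((n : ℝ) + 1) ^ 2 * Tp n (L + 2) (derivative g) := by
  have e1 : Tp (n + 1) (L + 1) g = ∑ m ∈ Finset.Ico n L, (2 * (m : ℝ) + 3) * Ip (m + 1) g ^ 2 := by
    rw [Tp, ← Finset.sum_Ico_add']
    refine Finset.sum_congr rfl fun m _ => ?_
    push_cast; ring
  set c := fun m => Ip m (derivative g) with hc
  have e2 : ∀ m ∈ Finset.Ico n L, (2 * (m : ℝ) + 3) * Ip (m + 1) g ^ 2 ≤
      1 / ((n : ℝ) + 1) ^ 2 * ((2 * (m : ℝ) + 1) * c m ^ 2 + (2 * ((m + 2 : ℕ) : ℝ) + 1) * c (m + 2) ^ 2) := by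
    intro m hm
    have hnm : (n : ℝ) ≤ m := by exact_mod_cast (Finset.mem_Ico.1 hm).1
    have hn0 : (0 : ℝ) ≤ n := by positivity
    have h := Ip_rec m g
    have h' : ((2 * (m : ℝ) + 3) * Ip (m + 1) g ^ 2) * (2 * (m : ℝ) + 3) = (c m - c (m + 2)) ^ 2 := by
      rw [hc]; simp only; rw [← h]; ring
    rw [one_div_mul_eq_div, le_div_iff₀ (by positivity)]
    have hpos : (0 : ℝ) < 2 * m + 3 := by positivity
    apply le_of_mul_le_mul_right _ hpos
    push_cast
    calc (2 * (m : ℝ) + 3) * Ip (m + 1) g ^ 2 * ((n : ℝ) + 1) ^ 2 * (2 * m + 3)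
        = ((n : ℝ) + 1) ^ 2 * (c m - c (m + 2)) ^ 2 := by rw [← h']; ring
      _ ≤ ((m : ℝ) + 1) ^ 2 * (2 * c m ^ 2 + 2 * c (m + 2) ^ 2) := by
          gcongr
          nlinarith [sq_nonneg (c m + c (m + 2))]
      _ ≤ _ := by
          have h1 : ((m : ℝ) + 1) ^ 2 * 2 ≤ (2 * m + 1) * (2 * m + 3) := by nlinarith
          have h2 : ((m : ℝ) + 1) ^ 2 * 2 ≤ (2 * (m + 2) + 1) * (2 * m + 3) := by nlinarith
          have h3 := mul_le_mul_of_nonneg_right h1 (sq_nonneg (c m))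
          have h4 := mul_le_mul_of_nonneg_right h2 (sq_nonneg (c (m + 2)))
          nlinarith
  rw [e1]
  refine (Finset.sum_le_sum e2).trans ?_
  rw [← Finset.mul_sum, Finset.sum_add_distrib]
  have e3 : ∑ m ∈ Finset.Ico n L, (2 * ((m + 2 : ℕ) : ℝ) + 1) * c (m + 2) ^ 2
      = Tp (n + 2) (L + 2) (derivative g) := by
    rw [Tp, ← Finset.sum_Ico_add']
  have e4 : ∑ m ∈ Finset.Ico n L, (2 * (m : ℝ) + 1) * c m ^ 2 = Tp n L (derivative g) := rfl
  rw [e3, e4]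
  have h1 := Tp_mono (le_refl n) (show L ≤ L + 2 by omega) (derivative g)
  have h2 := Tp_mono (show n ≤ n + 2 by omega) (le_refl (L + 2)) (derivative g)
  have : 0 ≤ 1 / ((n : ℝ) + 1) ^ 2 := by positivity
  calc _ ≤ 1 / ((n : ℝ) + 1) ^ 2 * (2 * Tp n (L + 2) (derivative g)) := by
        apply mul_le_mul_of_nonneg_left _ this; linarith
    _ = _ := by ring

lemma Tp_bound (k : ℕ) : ∃ A : ℝ, 0 < A ∧ ∀ (g : ℝ[X]) (M : ℝ),
    (∀ t ∈ Icc (-1 : ℝ) 1, |(derivative^[k] g).eval t| ≤ M) → ∀ n, k + 1 ≤ n → ∀ L,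
    Tp n L g ≤ A * M ^ 2 / (n : ℝ) ^ (2 * k) := by
  induction k with
  | zero =>
    refine ⟨4, by norm_num, fun g M hM n _ L => ?_⟩
    have := bessel L g M hM
    have h2 := Tp_mono (Nat.zero_le n) (le_refl L) g
    simp only [mul_zero, pow_zero, div_one]
    refine h2.trans ?_
    simpa [Tp] using this
  | succ k ih =>
    obtain ⟨A, hA, h⟩ := ih
    refine ⟨2 * 4 ^ k * A, by positivity, fun g M hM n hn L => ?_⟩
    obtain ⟨n, rfl⟩ : ∃ n', n = n' + 1 := ⟨n - 1, by omega⟩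
    have h1 := h (derivative g) M hM n (by omega) (L + 2)
    have h2 := Tp_step n L g
    have h3 := Tp_mono (le_refl (n + 1)) (show L ≤ L + 1 by omega) g
    have hn1 : (1 : ℝ) ≤ n := by exact_mod_cast (show 1 ≤ n by omega)
    refine h3.trans (h2.trans ((mul_le_mul_of_nonneg_left h1 (by positivity)).trans ?_))
    push_cast
    rw [div_mul_div_comm, div_le_div_iff₀ (by positivity) (by positivity)]
    have h4 : ((n : ℝ) + 1) ^ (2 * k) ≤ 4 ^ k * (n : ℝ) ^ (2 * k) := by
      calc ((n : ℝ) + 1) ^ (2 * k) ≤ (2 * (n : ℝ)) ^ (2 * k) := by gcongr; linarith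
        _ = _ := by rw [mul_pow, pow_mul 2 2 k]; norm_num
    calc 2 * (A * M ^ 2) * ((n : ℝ) + 1) ^ (2 * (k + 1))
        = (2 * (A * M ^ 2) * ((n : ℝ) + 1) ^ 2) * ((n : ℝ) + 1) ^ (2 * k) := by ring
      _ ≤ (2 * (A * M ^ 2) * ((n : ℝ) + 1) ^ 2) * (4 ^ k * (n : ℝ) ^ (2 * k)) := by gcongr
      _ = _ := by ring

lemma abel_sum (c p : ℕ → ℝ) (N L : ℕ) (h : N ≤ L) :
    ∑ n ∈ Finset.Ico N L, (c n - c (n + 2)) * p (n + 1) =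
      ∑ n ∈ Finset.Ico N L, c (n + 2) * (p (n + 3) - p (n + 1)) + c N * p (N + 1)
        + c (N + 1) * p (N + 2) - c L * p (L + 1) - c (L + 1) * p (L + 2) := by
  induction L, h using Nat.le_induction with
  | base => simp
  | succ L h ih =>
    rw [Finset.sum_Ico_succ_top h, Finset.sum_Ico_succ_top h, ih]; ring

lemma tele_bound (N L : ℕ) (h : N ≤ L) :
    ∑ n ∈ Finset.Ico N L, 4 / ((n : ℝ) + 2) ^ 2 ≤ 4 / ((N : ℝ) + 1) - 4 / ((L : ℝ) + 1) := by
  induction L, h using Nat.le_induction with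
  | base => simp
  | succ L h ih =>
    rw [Finset.sum_Ico_succ_top h]
    have : 4 / ((L : ℝ) + 2) ^ 2 ≤ 4 / ((L : ℝ) + 1) - 4 / (((L + 1 : ℕ) : ℝ) + 1) := by
      push_cast
      rw [div_sub_div _ _ (by positivity) (by positivity), div_le_div_iff₀ (by positivity) (by positivity)]
      have : (0 : ℝ) ≤ L := by positivity
      nlinarith
    linarith

lemma poly_main (p : ℕ) : ∃ A : ℝ, 0 < A ∧ ∀ (g : ℝ[X]) (M : ℝ),
    (∀ t ∈ Icc (-1 : ℝ) 1, |(derivative^[p + 1] g).eval t| ≤ M) → ∀ N, p + 1 < N →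
    ∀ t ∈ Icc (-1 : ℝ) 1,
    (g.eval t - (Sp (N + 1) g).eval t) ^ 2 ≤ A * M ^ 2 / (N : ℝ) ^ (2 * p + 1) := by
  obtain ⟨A, hA, hT⟩ := Tp_bound p
  refine ⟨20 * A, by positivity, fun g M hM N hN t ht => ?_⟩
  have hN0 : (0 : ℝ) < N := by exact_mod_cast (show 0 < N by omega)
  set c := fun m => Ip m (derivative g) with hc
  set q := fun m => (legendreP m).eval t with hq
  obtain ⟨L1, hL1⟩ := Sp_eventually g
  obtain ⟨L2, hL2⟩ := Ip_eventually (derivative g)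
  set L := max (max L1 L2) N with hLdef
  have hLN : N ≤ L := le_max_right _ _
  have hLL1 : L1 ≤ L := le_trans (le_max_left _ _) (le_max_left _ _)
  have hLL2 : L2 ≤ L := le_trans (le_max_right _ _) (le_max_left _ _)
  have hg := hL1 (L + 1) (by omega)
  have hcL : c L = 0 := hL2 L hLL2
  have hcL1 : c (L + 1) = 0 := hL2 (L + 1) (by omega)
  set T := Tp N (L + 2) (derivative g) with hTdef
  have hTb : T ≤ A * M ^ 2 / (N : ℝ) ^ (2 * p) := hT (derivative g) M hM N (by omega) _
  -- the remainder
  have hr : g.eval t - (Sp (N + 1) g).eval t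
      = 1 / 2 * ∑ n ∈ Finset.Ico N L, (c n - c (n + 2)) * q (n + 1) := by
    conv_lhs => rw [← congrArg (eval t) hg]
    simp only [Sp, eval_finsetSum]
    rw [← Finset.sum_Ico_eq_sub _ (by omega), ← Finset.sum_Ico_add', Finset.mul_sum]
    refine Finset.sum_congr rfl fun n _ => ?_
    have := Ip_rec n g
    simp only [eval_mul, eval_C, hc, hq]
    rw [← this]; push_cast; ring
  rw [abel_sum c q N L hLN, hcL, hcL1] at hr
  set S := ∑ n ∈ Finset.Ico N L, c (n + 2) * (q (n + 3) - q (n + 1)) with hS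
  -- main sum
  have hS2 : S ^ 2 ≤ T * (4 / N) := by
    have h1 : S ^ 2 ≤ (∑ n ∈ Finset.Ico N L, (2 * ((n + 2 : ℕ) : ℝ) + 1) * c (n + 2) ^ 2) *
        ∑ n ∈ Finset.Ico N L, (q (n + 3) - q (n + 1)) ^ 2 / (2 * ((n + 2 : ℕ) : ℝ) + 1) := by
      apply Finset.sum_sq_le_sum_mul_sum_of_sq_le_mul
      · intro i _; positivity
      · intro i _; positivity
      · intro i _
        have : (2 * ((i + 2 : ℕ) : ℝ) + 1) ≠ 0 := by positivity
        apply le_of_eq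
        field_simp
    have h2 : ∑ n ∈ Finset.Ico N L, (2 * ((n + 2 : ℕ) : ℝ) + 1) * c (n + 2) ^ 2 ≤ T := by
      have : ∑ n ∈ Finset.Ico N L, (2 * ((n + 2 : ℕ) : ℝ) + 1) * c (n + 2) ^ 2
          = Tp (N + 2) (L + 2) (derivative g) := by rw [Tp, ← Finset.sum_Ico_add']
      rw [this]; exact Tp_mono (by omega) le_rfl _
    have h3 : ∑ n ∈ Finset.Ico N L, (q (n + 3) - q (n + 1)) ^ 2 / (2 * ((n + 2 : ℕ) : ℝ) + 1)
        ≤ 4 / (N : ℝ) := by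
      have : ∀ n ∈ Finset.Ico N L, (q (n + 3) - q (n + 1)) ^ 2 / (2 * ((n + 2 : ℕ) : ℝ) + 1)
          ≤ 4 / ((n : ℝ) + 2) ^ 2 := by
        intro n _
        have := legendreP_diff_bound (n + 1) ht
        rw [div_le_iff₀ (by positivity)]
        refine this.trans (le_of_eq ?_)
        push_cast; ring
      refine (Finset.sum_le_sum this).trans ((tele_bound N L hLN).trans ?_)
      have h5 : 4 / ((N : ℝ) + 1) ≤ 4 / N := by gcongr; linarith
      have h6 : 0 ≤ 4 / ((L : ℝ) + 1) := by positivity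
      linarith
    refine h1.trans (mul_le_mul h2 h3 (Finset.sum_nonneg fun i _ => by positivity) ?_)
    exact Finset.sum_nonneg fun i _ => by positivity
  have hcb : ∀ m, N ≤ m → m < L + 2 → (c m * q (m + 1)) ^ 2 ≤ T / N := by
    intro m h1 h2
    have h3 : (2 * (m : ℝ) + 1) * c m ^ 2 ≤ T :=
      Finset.single_le_sum (f := fun m : ℕ => (2 * (m : ℝ) + 1) * c m ^ 2)
        (fun i _ => by positivity) (Finset.mem_Ico.2 ⟨h1, h2⟩)
    have h4 : q (m + 1) ^ 2 ≤ 1 := legendreP_sq_le_one _ ht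
    have h5 : (N : ℝ) ≤ m := by exact_mod_cast h1
    rw [le_div_iff₀ hN0, mul_pow]
    have h6 : c m ^ 2 * q (m + 1) ^ 2 ≤ c m ^ 2 := mul_le_of_le_one_right (sq_nonneg _) h4
    nlinarith [sq_nonneg (c m), sq_nonneg (c m * q (m+1))]
  have hb1 := hcb N le_rfl (by omega)
  have hb2 := hcb (N + 1) (by omega) (by omega)
  have hfin : (g.eval t - (Sp (N + 1) g).eval t) ^ 2 ≤ 20 * (T / N) := by
    rw [hr]
    have hS3 : S ^ 2 ≤ 4 * (T / N) := hS2.trans (le_of_eq (by ring))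
    have : 0 ≤ T / N := le_trans (sq_nonneg _) hb1
    simp only [zero_mul, sub_zero]
    rw [show N + 1 + 1 = N + 2 by ring] at hb2
    set a := c N * q (N + 1)
    set b := c (N + 1) * q (N + 2)
    nlinarith [sq_nonneg (S - a), sq_nonneg (S - b), sq_nonneg (a - b)]
  refine hfin.trans ?_
  calc 20 * (T / N) ≤ 20 * (A * M ^ 2 / (N : ℝ) ^ (2 * p) / N) := by gcongr
    _ = _ := by rw [div_div, ← pow_succ]; ring

/-! ### Approximation of smooth functions by polynomials -/

lemma poly_anti (g : ℝ[X]) : ∃ G : ℝ[X], derivative G = g := by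
  induction g using Polynomial.induction_on' with
  | add p q hp hq =>
    obtain ⟨P, rfl⟩ := hp
    obtain ⟨Q, rfl⟩ := hq
    exact ⟨P + Q, by simp⟩
  | monomial n a =>
    refine ⟨monomial (n + 1) (a / ((n : ℝ) + 1)), ?_⟩
    rw [derivative_monomial]
    have : (n : ℝ) + 1 ≠ 0 := by positivity
    simp [this]

lemma poly_approx {a b : ℝ} (hab : a < b) (k : ℕ) : ∀ f : ℝ → ℝ, ContDiffOn ℝ (k : ℕ∞) f (Icc a b) →
    ∀ ε : ℝ, 0 < ε → ∃ g : ℝ[X], ∀ t ∈ Icc a b, |f t - g.eval t| ≤ ε ∧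
      |iteratedDerivWithin k f (Icc a b) t - (derivative^[k] g).eval t| ≤ ε := by
  induction k with
  | zero =>
    intro f hf ε hε
    obtain ⟨g, hg⟩ := exists_polynomial_near_of_continuousOn a b f hf.continuousOn ε hε
    refine ⟨g, fun t ht => ?_⟩
    have := (hg t ht).le
    rw [abs_sub_comm] at this
    simpa using this
  | succ k ih =>
    intro f hf ε hε
    have hu : UniqueDiffOn ℝ (Icc a b) := uniqueDiffOn_Icc hab
    have hf' : ContDiffOn ℝ (k : ℕ∞) (derivWithin f (Icc a b)) (Icc a b) :=
      hf.derivWithin hu (by norm_cast)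
    have hdiff : DifferentiableOn ℝ f (Icc a b) := hf.differentiableOn (by simp)
    have hba : 0 < b - a := sub_pos.2 hab
    have hpos : 0 < 1 + (b - a) := by linarith
    obtain ⟨g1, hg1⟩ := ih _ hf' (ε / (1 + (b - a))) (by positivity)
    obtain ⟨G, hG⟩ := poly_anti g1
    have hle : ε / (1 + (b - a)) ≤ ε := div_le_self hε.le (by linarith)
    refine ⟨G + C (f a - G.eval a), fun t ht => ⟨?_, ?_⟩⟩
    · have hd : ∀ s ∈ Icc a b, HasDerivWithinAt (fun s => f s - G.eval s)
          (derivWithin f (Icc a b) s - g1.eval s) (Icc a b) s := by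
        intro s hs
        have h1 := (hdiff s hs).hasDerivWithinAt
        have h2 := (G.hasDerivAt s).hasDerivWithinAt (s := Icc a b)
        rw [hG] at h2
        exact h1.sub h2
      have hb := Convex.norm_image_sub_le_of_norm_hasDerivWithin_le hd
        (fun s hs => (hg1 s hs).1) (convex_Icc a b) (left_mem_Icc.2 hab.le) ht
      have e : f t - eval t (G + C (f a - eval a G)) = (f t - eval t G) - (f a - eval a G) := by
        simp; ring
      rw [e]
      refine le_trans hb ?_
      rw [Real.norm_eq_abs, abs_of_nonneg (by linarith [ht.1]), div_mul_eq_mul_div,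
        div_le_iff₀ hpos]
      have : t - a ≤ 1 + (b - a) := by linarith [ht.2]
      gcongr
    · rw [iteratedDerivWithin_succ', Function.iterate_succ_apply, derivative_add, derivative_C,
        add_zero, hG]
      exact ((hg1 t ht).2).trans hle

/-- the truncated Legendre series on `[-x, x]` -/
def SR (N : ℕ) (x : ℝ) (f : ℝ → ℝ) (t : ℝ) : ℝ :=
  ∑ n ∈ Finset.range (N + 1), (x⁻¹ * (legendreP n).eval (t / x)) *
    ((2 * (n : ℝ) + 1) / 2 * ∫ s in (-x)..x, (legendreP n).eval (s / x) * f s)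

lemma iterD_comp (k : ℕ) (x : ℝ) (g : ℝ[X]) : derivative^[k] (g.comp (C x * X)) =
    C (x ^ k) * (derivative^[k] g).comp (C x * X) := by
  induction k with
  | zero => simp
  | succ k ih =>
    rw [Function.iterate_succ_apply', ih, Function.iterate_succ_apply', derivative_C_mul,
      derivative_comp]
    simp [pow_succ]; ring

lemma SR_poly (N : ℕ) {x : ℝ} (hx : 0 < x) (g : ℝ[X]) (t : ℝ) :
    SR N x (fun s => g.eval s) t = (Sp (N + 1) (g.comp (C x * X))).eval (t / x) := by
  simp only [SR, Sp, eval_finsetSum]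
  refine Finset.sum_congr rfl fun n _ => ?_
  have h : ∫ s in (-x)..x, (legendreP n).eval (s / x) * g.eval s = x * Ip n (g.comp (C x * X)) := by
    have := intervalIntegral.integral_comp_mul_left (a := -1) (b := 1)
      (fun s => (legendreP n).eval (s / x) * g.eval s) hx.ne'
    simp only [mul_neg, mul_one, smul_eq_mul] at this
    rw [Ip, Jp]
    have e : ∀ u : ℝ, eval u (g.comp (C x * X) * legendreP n)
       = (legendreP n).eval (x * u / x) * g.eval (x * u) := by
      intro u
      rw [mul_div_cancel_left₀ _ hx.ne']; simp only [eval_mul, eval_comp, eval_C, eval_X]; ring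
    simp only [e]
    rw [this]
    field_simp
  rw [h]
  simp only [eval_mul, eval_C]
  field_simp

lemma poly_scaled (p : ℕ) : ∃ A : ℝ, 0 < A ∧ ∀ (x : ℝ), 0 < x → ∀ (g : ℝ[X]) (M : ℝ),
    (∀ t ∈ Icc (-x) x, |(derivative^[p + 1] g).eval t| ≤ M) → ∀ N : ℕ, p + 1 < N →
    ∀ t ∈ Icc (-x) x,
    |g.eval t - SR N x (fun s => g.eval s) t| ≤ A * M * (x ^ (p + 1) / (N : ℝ) ^ ((p : ℝ) + 1 / 2)) := by
  obtain ⟨A, hA, h⟩ := poly_main p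
  refine ⟨√A, Real.sqrt_pos.2 hA, fun x hx g M hM N hN t ht => ?_⟩
  have hN0 : (0 : ℝ) < N := by exact_mod_cast (show 0 < N by omega)
  have hM0 : 0 ≤ M := (abs_nonneg _).trans (hM t ht)
  have ht' : t / x ∈ Icc (-1 : ℝ) 1 :=
    ⟨by rw [le_div_iff₀ hx]; linarith [ht.1], by rw [div_le_iff₀ hx]; linarith [ht.2]⟩
  have h1 := h (g.comp (C x * X)) (x ^ (p + 1) * M) (by
    intro u hu
    rw [iterD_comp]
    simp only [eval_mul, eval_C, eval_comp, eval_X]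
    rw [abs_mul, abs_of_pos (by positivity)]
    gcongr
    exact hM _ ⟨by nlinarith [hu.1], by nlinarith [hu.2]⟩) N hN (t / x) ht'
  rw [← SR_poly N hx] at h1
  have e : (g.comp (C x * X)).eval (t / x) = g.eval t := by
    simp; congr 1; field_simp
  rw [e] at h1
  apply abs_le_of_sq_le_sq _ (by positivity)
  refine h1.trans (le_of_eq ?_)
  rw [mul_pow (√A * M), mul_pow (√A), Real.sq_sqrt hA.le, div_pow, ← Real.rpow_mul_natCast hN0.le]
  rw [show ((p : ℝ) + 1 / 2) * ((2 : ℕ) : ℝ) = ((2 * p + 1 : ℕ) : ℝ) by push_cast; ring,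
    Real.rpow_natCast]
  ring

lemma SR_close (N : ℕ) {x : ℝ} (hx : 0 < x) {f g : ℝ → ℝ} (hf : ContinuousOn f (Icc (-x) x))
    (hg : ContinuousOn g (Icc (-x) x)) {ε : ℝ} (h : ∀ s ∈ Icc (-x) x, |f s - g s| ≤ ε)
    {t : ℝ} : |SR N x f t - SR N x g t| ≤
      (∑ n ∈ Finset.range (N + 1), |x⁻¹ * (legendreP n).eval (t / x)| *
        ((2 * (n : ℝ) + 1) / 2 * (2 * x))) * ε := by
  have hle : -x ≤ x := by linarith
  rw [SR, SR, ← Finset.sum_sub_distrib, Finset.sum_mul]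
  refine (Finset.abs_sum_le_sum_abs _ _).trans (Finset.sum_le_sum fun n _ => ?_)
  have hP : Continuous fun s : ℝ => (legendreP n).eval (s / x) := by fun_prop
  have hi1 : IntervalIntegrable (fun s => (legendreP n).eval (s / x) * f s) volume (-x) x :=
    ContinuousOn.intervalIntegrable (by rw [uIcc_of_le hle]; exact hP.continuousOn.mul hf)
  have hi2 : IntervalIntegrable (fun s => (legendreP n).eval (s / x) * g s) volume (-x) x :=
    ContinuousOn.intervalIntegrable (by rw [uIcc_of_le hle]; exact hP.continuousOn.mul hg)
  rw [← mul_sub, ← mul_sub, ← integral_sub hi1 hi2, abs_mul, abs_mul ((2 * (n : ℝ) + 1) / 2),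
    abs_of_nonneg (show (0 : ℝ) ≤ (2 * (n : ℝ) + 1) / 2 by positivity),
    mul_assoc |x⁻¹ * (legendreP n).eval (t / x)|, mul_assoc ((2 * (n : ℝ) + 1) / 2)]
  gcongr
  have := intervalIntegral.norm_integral_le_of_norm_le_const (a := -x) (b := x) (C := ε)
    (f := fun s => (legendreP n).eval (s / x) * f s - (legendreP n).eval (s / x) * g s) (by
      intro s hs
      rw [uIoc_of_le hle] at hs
      have hs' : s ∈ Icc (-x) x := ⟨hs.1.le, hs.2⟩
      have ht' : s / x ∈ Icc (-1 : ℝ) 1 :=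
        ⟨by rw [le_div_iff₀ hx]; linarith [hs'.1], by rw [div_le_iff₀ hx]; linarith [hs'.2]⟩
      have h1 : |(legendreP n).eval (s / x)| ≤ 1 :=
        (sq_le_one_iff_abs_le_one _).1 (legendreP_sq_le_one n ht')
      rw [← mul_sub, Real.norm_eq_abs, abs_mul]
      calc _ ≤ 1 * ε := mul_le_mul h1 (h s hs') (abs_nonneg _) zero_le_one
        _ = ε := one_mul ε)
  rw [Real.norm_eq_abs, show x - -x = 2 * x by ring, abs_of_pos (show 0 < 2 * x by linarith)] at this
  linarith

lemma real_main (p : ℕ) : ∃ A : ℝ, 0 < A ∧ ∀ (x : ℝ), 0 < x → ∀ (f : ℝ → ℝ) (M : ℝ),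
    ContDiffOn ℝ ((p + 1 : ℕ) : ℕ∞) f (Icc (-x) x) →
    (∀ t ∈ Icc (-x) x, |iteratedDerivWithin (p + 1) f (Icc (-x) x) t| ≤ M) → ∀ N : ℕ, p + 1 < N →
    ∀ t ∈ Icc (-x) x,
    |f t - SR N x f t| ≤ A * M * (x ^ (p + 1) / (N : ℝ) ^ ((p : ℝ) + 1 / 2)) := by
  obtain ⟨A, hA, h⟩ := poly_scaled p
  refine ⟨A, hA, fun x hx f M hf hM N hN t ht => ?_⟩
  set R := x ^ (p + 1) / (N : ℝ) ^ ((p : ℝ) + 1 / 2) with hR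
  have hR0 : 0 ≤ R := by positivity
  set D := (∑ n ∈ Finset.range (N + 1), |x⁻¹ * (legendreP n).eval (t / x)| *
        ((2 * (n : ℝ) + 1) / 2 * (2 * x))) with hD
  have hD0 : 0 ≤ D := Finset.sum_nonneg fun n _ => by positivity
  apply le_of_forall_pos_le_add
  intro δ hδ
  have hW : 0 < 1 + A * R + D := by positivity
  set ε := δ / (1 + A * R + D) with hε
  have hε0 : 0 < ε := by positivity
  obtain ⟨g, hg⟩ := poly_approx (show -x < x by linarith) (p + 1) f hf ε hε0
  have h1 := h x hx g (M + ε) (by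
    intro s hs
    have a1 := (hg s hs).2
    have a2 := hM s hs
    rw [abs_le] at *
    constructor <;> linarith) N hN t ht
  have h2 := SR_close N hx (t := t) hf.continuousOn g.continuous.continuousOn (fun s hs => (hg s hs).1)
  have h3 := (hg t ht).1
  have h4 : |f t - SR N x f t| ≤ |f t - g.eval t| + |g.eval t - SR N x (fun s => g.eval s) t|
      + |SR N x f t - SR N x (fun s => g.eval s) t| := by
    rw [abs_sub_comm (SR N x f t)]
    refine le_trans (le_of_eq ?_) ((abs_add_le _ _).trans (by gcongr; exact abs_add_le _ _))
    congr 1; ring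
  have h5 : ε * (1 + A * R + D) = δ := by rw [hε]; field_simp
  calc _ ≤ ε + A * (M + ε) * R + D * ε := by linarith
    _ = A * M * R + ε * (1 + A * R + D) := by ring
    _ = _ := by rw [h5]

/-! ### Matrices -/

lemma entry_le_opNorm (A : M2) (i j : Fin 2) : ‖A i j‖ ≤ opNorm A := by
  have h1 : (Matrix.toEuclideanCLM (𝕜 := ℂ) A (EuclideanSpace.single j 1)) i = A i j := by
    simp
  have h2 := PiLp.norm_apply_le (Matrix.toEuclideanCLM (𝕜 := ℂ) A (EuclideanSpace.single j 1)) i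
  rw [h1] at h2
  refine h2.trans (((Matrix.toEuclideanCLM (𝕜 := ℂ) A).le_opNorm _).trans ?_)
  simp [opNorm]

lemma opNorm_le_entries : ∃ E : ℝ, 0 < E ∧ ∀ (A : M2) (R : ℝ),
    (∀ i j, |(A i j).re| ≤ R ∧ |(A i j).im| ≤ R) → opNorm A ≤ E * R := by
  refine ⟨∑ i : Fin 2, ∑ j : Fin 2, 2 * opNorm (Matrix.single i j (1 : ℂ)) + 1, ?_, ?_⟩
  · have : 0 ≤ ∑ i : Fin 2, ∑ j : Fin 2, 2 * opNorm (Matrix.single i j (1 : ℂ)) :=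
      Finset.sum_nonneg fun i _ => Finset.sum_nonneg fun j _ =>
        mul_nonneg zero_le_two (norm_nonneg _)
    linarith
  · intro A R h
    have hR : 0 ≤ R := (abs_nonneg _).trans (h 0 0).1
    have e : A = ∑ i : Fin 2, ∑ j : Fin 2, (A i j) • Matrix.single i j (1 : ℂ) := by
      conv_lhs => rw [Matrix.matrix_eq_sum_single A]
      simp [Matrix.smul_single]
    have h1 : opNorm A ≤ ∑ i : Fin 2, ∑ j : Fin 2, 2 * R * opNorm (Matrix.single i j (1 : ℂ)) := by
      conv_lhs => rw [e]
      simp only [opNorm, map_sum, map_smul]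
      refine (norm_sum_le _ _).trans (Finset.sum_le_sum fun i _ => (norm_sum_le _ _).trans
        (Finset.sum_le_sum fun j _ => ?_))
      rw [norm_smul]
      gcongr
      have := Complex.norm_le_abs_re_add_abs_im (A i j)
      linarith [(h i j).1, (h i j).2]
    refine h1.trans ?_
    rw [add_mul, Finset.sum_mul]
    refine le_trans (le_of_eq ?_) (le_add_of_nonneg_right (by linarith))
    refine Finset.sum_congr rfl fun i _ => ?_
    rw [Finset.sum_mul]
    refine Finset.sum_congr rfl fun j _ => by ring

lemma gen_KN {E : Type*} [NormedAddCommGroup E] [NormedSpace ℝ E] [CompleteSpace E]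
    (φ : E →L[ℝ] ℝ) (F : ℝ → E) (N : ℕ) {x : ℝ} (hx : 0 < x) (t : ℝ)
    (hK : ContinuousOn F (Icc (-x) x)) :
    φ (∑ n ∈ Finset.range (N + 1), (x⁻¹ * (legendreP n).eval (t / x)) •
      (((2 * (n : ℝ) + 1) / 2) • ∫ t in (-x)..x, ((legendreP n).eval (t / x)) • F t))
      = SR N x (fun s => φ (F s)) t := by
  simp only [SR, map_sum, map_smul, smul_eq_mul]
  refine Finset.sum_congr rfl fun n _ => ?_
  congr 2
  have hle : -x ≤ x := by linarith
  have hP : Continuous fun s : ℝ => (legendreP n).eval (s / x) := by fun_prop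
  have hi : IntervalIntegrable (fun s => (legendreP n).eval (s / x) • F s) volume (-x) x :=
    ContinuousOn.intervalIntegrable (by rw [uIcc_of_le hle]; exact hP.continuousOn.smul hK)
  rw [← φ.intervalIntegral_comp_comm hi]
  simp

lemma gen_bound (p : ℕ) : ∃ A : ℝ, 0 < A ∧ ∀ {E : Type} [NormedAddCommGroup E] [NormedSpace ℝ E]
    [FiniteDimensional ℝ E] (nrm : E → ℝ) (φ : E →ₗ[ℝ] ℝ), (∀ B : E, |φ B| ≤ nrm B) →
    ∀ (b : ℝ) (K : ℝ → ℝ → E),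
      ContDiffOn ℝ ((p : ℕ∞) + 1) (fun z : ℝ × ℝ => K z.1 z.2) (OmegaPlus b) →
      ∀ M : ℝ,
        (∀ x t : ℝ, (x, t) ∈ OmegaPlus b →
          nrm (iteratedDerivWithin (p + 1) (fun s => K x s) (Set.Icc (-x) x) t) ≤ M) →
        ∀ N : ℕ, p + 1 < N → ∀ x t : ℝ, (x, t) ∈ OmegaPlus b → 0 < x →
          |φ (K x t - ∑ n ∈ Finset.range (N + 1), (x⁻¹ * (legendreP n).eval (t / x)) •
            (((2 * (n : ℝ) + 1) / 2) • ∫ t in (-x)..x, ((legendreP n).eval (t / x)) • K x t))|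
            ≤ A * M * (x ^ (p + 1) / (N : ℝ) ^ ((p : ℝ) + 1 / 2)) := by
  obtain ⟨A, hA, h⟩ := real_main p
  refine ⟨A, hA, ?_⟩
  intro E _ _ _ nrm φ0 hφ0 b K hK M hM N hN x t hxt hx
  haveI : CompleteSpace E := FiniteDimensional.complete ℝ E
  obtain ⟨φ, hφe⟩ : ∃ φ : E →L[ℝ] ℝ, ∀ B, φ B = φ0 B :=
    ⟨LinearMap.toContinuousLinearMap φ0, fun B => rfl⟩
  rw [← hφe]
  have hφ : ∀ B : E, |φ B| ≤ nrm B := fun B => by rw [hφe]; exact hφ0 B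
  have hmem : ∀ s ∈ Icc (-x) x, (x, s) ∈ OmegaPlus b := fun s hs =>
    ⟨hxt.1, hxt.2.1, abs_le.2 hs⟩
  have hKx : ContDiffOn ℝ ((p + 1 : ℕ) : ℕ∞) (K x) (Icc (-x) x) := by
    have h1 : ContDiffOn ℝ ((p : ℕ∞) + 1) (fun s : ℝ => (x, s)) (Icc (-x) x) := by
      exact (contDiff_const.prodMk contDiff_id).contDiffOn
    have := hK.comp h1 hmem
    simpa [Function.comp_def] using this
  have hu : UniqueDiffOn ℝ (Icc (-x) x) := uniqueDiffOn_Icc (by linarith)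
  rw [map_sub, gen_KN φ (K x) N hx t hKx.continuousOn]
  refine h x hx (fun s => φ (K x s)) M (φ.contDiff.comp_contDiffOn hKx) ?_ N hN t (abs_le.1 hxt.2.2)
  intro s hs
  have e : iteratedDerivWithin (p + 1) (fun s => φ (K x s)) (Icc (-x) x) s
      = φ (iteratedDerivWithin (p + 1) (K x) (Icc (-x) x) s) := by
    have := φ.iteratedFDerivWithin_comp_left (hKx s hs) hu hs (i := p + 1) (by norm_cast)
    exact congrArg (fun m => m (fun _ => 1)) this
  rw [e]
  exact (hφ _).trans (hM x s (hmem s hs))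

lemma phi_bound (p : ℕ) : ∃ A : ℝ, 0 < A ∧ ∀ (φ : M2 →ₗ[ℝ] ℝ), (∀ B : M2, |φ B| ≤ opNorm B) →
    ∀ (b : ℝ) (K : ℝ → ℝ → M2),
      ContDiffOn ℝ ((p : ℕ∞) + 1) (fun z : ℝ × ℝ => K z.1 z.2) (OmegaPlus b) →
      ∀ M : ℝ,
        (∀ x t : ℝ, (x, t) ∈ OmegaPlus b →
          opNorm (iteratedDerivWithin (p + 1) (fun s => K x s) (Set.Icc (-x) x) t) ≤ M) →
        ∀ N : ℕ, p + 1 < N → ∀ x t : ℝ, (x, t) ∈ OmegaPlus b → 0 < x →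
          |φ (K x t - KN K N x t)| ≤ A * M * (x ^ (p + 1) / (N : ℝ) ^ ((p : ℝ) + 1 / 2)) := by
  obtain ⟨A, hA, h⟩ := gen_bound p
  refine ⟨A, hA, fun φ hφ b K hK M hM N hN x t hxt hx => ?_⟩
  haveI : FiniteDimensional ℝ M2 := inferInstance
  exact h opNorm φ hφ b K hK M hM N hN x t hxt hx

/-- pointwise rate of convergence of the truncated Fourier–Legendre series
of the kernel. -/
theorem statement13 (p : ℕ) :
    ∃ C : ℝ, 0 < C ∧ ∀ b : ℝ, 0 < b → ∀ pf qf : ℝ → ℂ, ∀ K : ℝ → ℝ → M2,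
      ContDiffOn ℝ ((p : ℕ∞) + 1) (diracPot pf qf) (Set.Icc 0 b) →
      ContDiffOn ℝ ((p : ℕ∞) + 1) (fun z : ℝ × ℝ => K z.1 z.2) (OmegaPlus b) →
      IsTransKernel b (diracPot pf qf) K →
      ∀ M : ℝ,
        (∀ x t : ℝ, (x, t) ∈ OmegaPlus b →
          opNorm (iteratedDerivWithin (p + 1) (fun s => K x s) (Set.Icc (-x) x) t) ≤ M) →
        ∀ N : ℕ, p + 1 < N → ∀ x t : ℝ, (x, t) ∈ OmegaPlus b → 0 < x →
          opNorm (K x t - KN K N x t)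
            ≤ C * M * x ^ (p + 1) / (N : ℝ) ^ ((p : ℝ) + 1 / 2) := by
  obtain ⟨A, hA, h⟩ := phi_bound p
  obtain ⟨E, hE, hEn⟩ := opNorm_le_entries
  refine ⟨E * A, by positivity, ?_⟩
  intro b _ pf qf K _ hK _ M hM N hN x t hxt hx
  have key := hEn (K x t - KN K N x t) (A * M * (x ^ (p + 1) / (N : ℝ) ^ ((p : ℝ) + 1 / 2))) (by
    intro i j
    let ent : M2 →ₗ[ℝ] ℂ := { toFun := fun B => B i j, map_add' := fun _ _ => rfl, map_smul' := fun _ _ => rfl }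
    constructor
    · exact h (Complex.reLm.comp ent)
        (fun B => (Complex.abs_re_le_norm _).trans (entry_le_opNorm B i j)) b K hK M hM N hN x t hxt hx
    · exact h (Complex.imLm.comp ent)
        (fun B => (Complex.abs_im_le_norm _).trans (entry_le_opNorm B i j)) b K hK M hM N hN x t hxt hx)
  refine key.trans (le_of_eq ?_)
  ring

end
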